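/- For every integer n ≥ 1, the generalized FiboCatalan number for r = 1, namely 2·F_{2n}!/(F_{n+2}!·F_n!), is a positive integer; that is, F_{n+2}!·F_n! divides 2·F_{2n}!. -/

import Mathlib

/-- The Fibonacci factorial `F_n! = F_n F_{n-1} ⋯ F_2 F_1`, with `F_0! = 1`. -/
def fibFact : ℕ → ℕ
  | 0 => 1
  | n + 1 => Nat.fib (n + 1) * fibFact n

theorem fibFact_pos_aux (n : ℕ) : 0 < fibFact n := by
  induction n with
  | zero => simp [fibFact]
  | succ k ih =>
    rw [fibFact]
    exact Nat.mul_pos (Nat.fib_pos.2 (Nat.succ_pos k)) ih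

theorem fibFact_mul_dvd_aux (s : ℕ) :
    ∀ a b : ℕ, a + b = s → fibFact a * fibFact b ∣ fibFact (a + b) := by
  induction s with
  | zero =>
    intro a b h
    obtain ⟨rfl, rfl⟩ : a = 0 ∧ b = 0 := by omega
    simp [fibFact]
  | succ s ih =>
    intro a b h
    rcases a with _ | a
    · simp [fibFact]
    rcases b with _ | b
    · simp [fibFact]
    have h1 := ih a (b + 1) (by omega)
    have h2 := ih (a + 1) b (by omega)
    have e1 : a + (b + 1) = a + b + 1 := by omega
    have e2 : a + 1 + b = a + b + 1 := by omega
    have e3 : a + 1 + (b + 1) = a + b + 1 + 1 := by omega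
    rw [e1] at h1
    rw [e2] at h2
    rw [e3, fibFact.eq_2 (a + b + 1)]
    have hf : Nat.fib (a + b + 1 + 1)
        = Nat.fib (a + 1) * Nat.fib b + Nat.fib (a + 2) * Nat.fib (b + 1) := by
      rw [← Nat.fib_add (a + 1) b]; congr 1; omega
    rw [hf, add_mul]
    apply dvd_add
    · have := mul_dvd_mul_left (Nat.fib (a + 1)) h1
      rw [fibFact.eq_2 a]
      refine dvd_trans ?_ (this.trans ⟨Nat.fib b, by ring⟩)
      exact dvd_of_eq (by ring)
    · have := mul_dvd_mul_left (Nat.fib (b + 1)) h2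
      rw [fibFact.eq_2 b]
      refine dvd_trans ?_ (this.trans ⟨Nat.fib (a + 2), by ring⟩)
      exact dvd_of_eq (by ring)

theorem generalizedFiboCatalan_r_one_int (n : ℕ) (hn : 1 ≤ n) :
    fibFact (n + 2) * fibFact n ∣ 2 * fibFact (2 * n) := by
  obtain rfl | ⟨m, rfl⟩ : n = 1 ∨ ∃ m, n = m + 2 := by
    rcases n with _ | _ | m
    · omega
    · exact Or.inl rfl
    · exact Or.inr ⟨m, rfl⟩
  · simp [fibFact, Nat.fib_add_two]
  obtain ⟨B, hB⟩ := fibFact_mul_dvd_aux _ (m + 2) (m + 2) rfl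
  obtain ⟨C, hC⟩ := fibFact_mul_dvd_aux _ (m + 3) (m + 1) rfl
  obtain ⟨D, hD⟩ := fibFact_mul_dvd_aux _ (m + 4) m rfl
  rw [show m + 2 + (m + 2) = 2 * (m + 2) by ring] at hB
  rw [show m + 3 + (m + 1) = 2 * (m + 2) by ring] at hC
  rw [show m + 4 + m = 2 * (m + 2) by ring] at hD
  have p0 := fibFact_pos_aux m
  have p1 := fibFact_pos_aux (m + 1)
  have p2 := fibFact_pos_aux (m + 2)
  have q2 : fibFact (m + 2) = Nat.fib (m + 2) * fibFact (m + 1) := rfl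
  have q1 : fibFact (m + 1) = Nat.fib (m + 1) * fibFact m := rfl
  have q3 : fibFact (m + 3) = Nat.fib (m + 3) * fibFact (m + 2) := rfl
  have q4 : fibFact (m + 4) = Nat.fib (m + 4) * fibFact (m + 3) := rfl
  have r1 : Nat.fib (m + 2) * B = Nat.fib (m + 3) * C := by
    apply Nat.eq_of_mul_eq_mul_left (Nat.mul_pos p2 p1)
    have := hB.symm.trans hC
    rw [q3] at this
    calc _ = fibFact (m + 2) * (Nat.fib (m + 2) * fibFact (m + 1)) * B := by ring
      _ = _ := by rw [← q2, this]; ring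
  have r2 : Nat.fib (m + 2) * (Nat.fib (m + 1) * B)
      = Nat.fib (m + 4) * (Nat.fib (m + 3) * D) := by
    apply Nat.eq_of_mul_eq_mul_left (Nat.mul_pos p2 p0)
    have := hB.symm.trans hD
    rw [q4, q3] at this
    calc _ = fibFact (m + 2) * (Nat.fib (m + 2) * (Nat.fib (m + 1) * fibFact m)) * B := by ring
      _ = _ := by rw [← q1, ← q2, this]; ring
  have d1 : Nat.fib (m + 3) ∣ B :=
    (Nat.fib_coprime_fib_succ (m + 2)).symm.dvd_of_dvd_mul_left ⟨C, r1⟩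
  have c2 : Nat.Coprime (Nat.fib (m + 4)) (Nat.fib (m + 2)) := by
    have h : Nat.gcd (m + 4) (m + 2) ∣ 2 := by
      have := Nat.dvd_sub (Nat.gcd_dvd_left (m + 4) (m + 2)) (Nat.gcd_dvd_right (m + 4) (m + 2))
      simpa [show m + 4 - (m + 2) = 2 by omega] using this
    have h2 := Nat.fib_dvd _ _ h
    rw [Nat.fib_gcd] at h2
    exact Nat.dvd_one.1 (by simpa using h2)
  have c3 : Nat.gcd (Nat.fib (m + 4)) (Nat.fib (m + 1)) ∣ 2 := by
    have h : Nat.gcd (m + 4) (m + 1) ∣ 3 := by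
      have := Nat.dvd_sub (Nat.gcd_dvd_left (m + 4) (m + 1)) (Nat.gcd_dvd_right (m + 4) (m + 1))
      simpa [show m + 4 - (m + 1) = 3 by omega] using this
    have h2 := Nat.fib_dvd _ _ h
    rw [Nat.fib_gcd] at h2
    exact h2
  have d2 : Nat.fib (m + 4) ∣ 2 * B := by
    have h := c2.dvd_of_dvd_mul_left ⟨_, r2⟩
    have h3 : Nat.fib (m + 4) ∣ Nat.gcd (Nat.fib (m + 4) * B) (Nat.fib (m + 1) * B) :=
      Nat.dvd_gcd (dvd_mul_right _ _) h
    rw [Nat.gcd_mul_right] at h3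
    exact h3.trans (mul_dvd_mul_right c3 B)
  have d : Nat.fib (m + 4) * Nat.fib (m + 3) ∣ 2 * B :=
    (Nat.fib_coprime_fib_succ (m + 3)).symm.mul_dvd_of_dvd_of_dvd d2 (d1.trans (dvd_mul_left _ _))
  obtain ⟨E, hE⟩ := d
  refine ⟨E, ?_⟩
  change _ = fibFact (m + 4) * _ * E
  rw [hB, q4, q3]
  calc _ = fibFact (m + 2) * fibFact (m + 2) * (2 * B) := by ring
    _ = _ := by rw [hE]; ring
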